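/- For every n ≥ 1 there exists a partition μ of n with all parts odd such that ℓ(μ) − v₂(z_μ) = a(n), where a(n) is the largest integer m with m(m+1)/2 ≤ n; consequently, for f = 2^{(n−ℓ(μ))/2} p_μ ∈ Δ, the inner product ⟨f, f⟩ has 2-adic valuation exactly n − a(n), so the exponent n − a(n) in the divisibility bound for inner products of degree-n elements of Δ cannot be improved. -/

import Mathlib

open MvPolynomial

noncomputable section

/-- `R = ℚ[p₁,p₃,p₅,…]`: the variable `X k` represents `p_{2k+1}`. -/
abbrev FockR : Type := MvPolynomial ℕ ℚ

/-- `Δ = ℤ₍₂₎[p₁, 2p₃, 4p₅, …]`: the smallest subring of `R` containing all constants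
with odd denominator (i.e. the image of `ℤ₍₂₎`) and the elements `2^k p_{2k+1}`. -/
def Delta : Subring FockR :=
  Subring.closure ({f | ∃ q : ℚ, Odd q.den ∧ f = C q} ∪
    {f | ∃ k : ℕ, f = (2 : FockR) ^ k * X k})

/-- `z_μ` (as a rational) for the partition with odd parts corresponding to the
exponent vector `d` (where `d k` is the multiplicity of the part `2k+1`). -/
def zExp (d : ℕ →₀ ℕ) : ℚ :=
  ∏ k ∈ d.support, ((2 * k + 1 : ℚ) ^ d k * (Nat.factorial (d k)))

/-- The bilinear form on `R` for which the monomials `p_μ` are orthogonal with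
`⟨p_μ, p_μ⟩ = z_μ`. -/
def innerP (f g : FockR) : ℚ :=
  ∑ d ∈ f.support, coeff d f * coeff d g * zExp d

/-- The exponent vector of `p_μ`: part `p = 2k+1` of `μ` contributes to the variable `X k`. -/
def toExp {n : ℕ} (μ : Nat.Partition n) : ℕ →₀ ℕ :=
  (μ.parts.map (fun p => Finsupp.single ((p - 1) / 2) 1)).sum

/-- `p_μ` as an element of `R`. -/
def pMu {n : ℕ} (μ : Nat.Partition n) : FockR := monomial (toExp μ) 1

/-- `z_μ` for a partition `μ`. -/
def zPart {n : ℕ} (μ : Nat.Partition n) : ℚ :=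
  (μ.parts.dedup.map
    (fun k => (k : ℚ) ^ μ.parts.count k * (Nat.factorial (μ.parts.count k)))).prod

/-- `q_n = Σ_{μ ⊢ n, odd parts} (2^{ℓ(μ)}/z_μ) p_μ`. -/
def qFun (n : ℕ) : FockR :=
  ∑ μ ∈ Nat.Partition.odds n, ((2 : ℚ) ^ (Multiset.card μ.parts) / zPart μ) • pMu μ

/-- The operator `p_μ^*` (composite of the `k·∂/∂p_k`), for a partition with exponent
vector `e`, given by its action on coefficients. -/
def pStar (e : ℕ →₀ ℕ) (f : FockR) : FockR :=
  ∑ d ∈ f.support,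
    (coeff d f * ∏ k ∈ e.support, ((2 * k + 1 : ℚ) ^ e k * ((d k).descFactorial (e k)))) •
      monomial (d - e) (1 : ℚ)

/-- `q_n^* = Σ_{μ ⊢ n, odd parts} (2^{ℓ(μ)}/z_μ) p_μ^*`. -/
def qStar (n : ℕ) (f : FockR) : FockR :=
  ∑ μ ∈ Nat.Partition.odds n, ((2 : ℚ) ^ (Multiset.card μ.parts) / zPart μ) • pStar (toExp μ) f

/-- `ε(n)`: 0 if `n` even, 1 if `n` odd. -/
def eps (n : ℕ) : ℕ := n % 2

/-- `a(n)`: the largest integer `m` with `m(m+1)/2 ≤ n`. -/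
def aFun (n : ℕ) : ℕ := Nat.findGreatest (fun m => m * (m + 1) ≤ 2 * n) n

/-- `z_μ` as a natural number. -/
def zNat {n : ℕ} (μ : Nat.Partition n) : ℕ :=
  (μ.parts.dedup.map
    (fun k => k ^ μ.parts.count k * Nat.factorial (μ.parts.count k))).prod


theorem aux_v2_pow (j : ℕ) : ∀ r, r < 2 ^ j →
    padicValNat 2 (2 ^ j + r).factorial + 1 = padicValNat 2 r.factorial + 2 ^ j := by
  induction j with
  | zero => intro r hr; obtain rfl : r = 0 := by simpa using hr
            simp
  | succ j ih =>
    intro r hr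
    have h1 := ih (r / 2) (by rw [pow_succ] at hr; omega)
    have hb : r % 2 < 2 := Nat.mod_lt _ (by norm_num)
    have e1 : 2 ^ (j + 1) + r = 2 * (2 ^ j + r / 2) + r % 2 := by rw [pow_succ]; omega
    have e2 : r.factorial = (2 * (r / 2) + r % 2).factorial := by
      congr 1; omega
    rw [e1, e2, padicValNat_factorial_mul_add _ hb, padicValNat_factorial_mul_add _ hb,
      padicValNat_factorial_mul, padicValNat_factorial_mul, pow_succ]
    omega

theorem aux_v2_sum (T : Finset ℕ) :
    padicValNat 2 (∑ i ∈ T, 2 ^ i).factorial + T.card = ∑ i ∈ T, 2 ^ i := by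
  induction T using Finset.induction_on_max with
  | empty => simp
  | insert a s h ih =>
    have ha : a ∉ s := fun h' => lt_irrefl _ (h a h')
    rw [Finset.sum_insert ha, Finset.card_insert_of_notMem ha]
    have := aux_v2_pow a (∑ i ∈ s, 2 ^ i) (Nat.geomSum_lt le_rfl h)
    omega

def gParts (S : Finset ℕ) : Multiset ℕ :=
  ∑ s ∈ S, Multiset.replicate (2 ^ (padicValNat 2 s)) (s / 2 ^ (padicValNat 2 s))

theorem gParts_sum (S : Finset ℕ) : (gParts S).sum = ∑ s ∈ S, s := by
  unfold gParts
  rw [Multiset.sum_sum]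
  refine Finset.sum_congr rfl fun s _ => ?_
  rw [Multiset.sum_replicate, smul_eq_mul, Nat.mul_div_cancel' pow_padicValNat_dvd]

theorem gParts_odd (S : Finset ℕ) (hS : 0 ∉ S) (p : ℕ) (hp : p ∈ gParts S) : Odd p := by
  unfold gParts at hp
  rw [Multiset.mem_sum] at hp
  obtain ⟨s, hs, h⟩ := hp
  obtain rfl := Multiset.eq_of_mem_replicate h
  have h0 : s ≠ 0 := fun h => hS (h ▸ hs)
  rw [← Nat.not_even_iff_odd, even_iff_two_dvd]
  intro hd
  have : 2 ^ (padicValNat 2 s + 1) ∣ s := by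
    rw [pow_succ]
    exact (Nat.dvd_div_iff_mul_dvd pow_padicValNat_dvd).1 hd
  exact pow_succ_padicValNat_not_dvd h0 this

theorem gParts_count (S : Finset ℕ) (k : ℕ) :
    padicValNat 2 ((gParts S).count k).factorial +
      (S.filter (fun s => s / 2 ^ (padicValNat 2 s) = k)).card = (gParts S).count k := by
  have hinj : Set.InjOn (padicValNat 2)
      (S.filter (fun s => s / 2 ^ (padicValNat 2 s) = k) : Finset ℕ) := by
    intro x hx y hy hxy
    simp only [Finset.coe_filter, Set.mem_setOf_eq] at hx hy
    rw [← Nat.mul_div_cancel' (pow_padicValNat_dvd (p := 2) (n := x)),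
      ← Nat.mul_div_cancel' (pow_padicValNat_dvd (p := 2) (n := y)), hx.2, hy.2, hxy]
  have hc : (gParts S).count k =
      ∑ i ∈ (S.filter (fun s => s / 2 ^ (padicValNat 2 s) = k)).image (padicValNat 2), 2 ^ i := by
    rw [Finset.sum_image hinj, Finset.sum_filter]
    unfold gParts
    rw [Multiset.count_sum']
    refine Finset.sum_congr rfl fun s _ => ?_
    rw [Multiset.count_replicate]
  rw [← Finset.card_image_of_injOn hinj, hc]
  exact aux_v2_sum _

theorem zNat_v2 {n : ℕ} (μ : Nat.Partition n) (ho : ∀ p ∈ μ.parts, Odd p) :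
    padicValNat 2 (zNat μ) =
      ∑ k ∈ μ.parts.toFinset, padicValNat 2 (μ.parts.count k).factorial := by
  have : zNat μ = ∏ k ∈ μ.parts.toFinset, (k ^ μ.parts.count k * Nat.factorial (μ.parts.count k)) := rfl
  have ho' : ∀ k ∈ μ.parts.toFinset, ¬ 2 ∣ k := fun k hk h =>
    (Nat.not_even_iff_odd.2 (ho k (Multiset.mem_toFinset.1 hk))) (even_iff_two_dvd.2 h)
  have hk0 : ∀ k ∈ μ.parts.toFinset, k ≠ 0 := fun k hk h => ho' k hk (h ▸ dvd_zero 2)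
  rw [this, ← Nat.factorization_def _ Nat.prime_two, Nat.factorization_prod
    (fun k hk => mul_ne_zero (pow_ne_zero _ (hk0 k hk)) (Nat.factorial_ne_zero _)),
    Finsupp.finset_sum_apply]
  refine Finset.sum_congr rfl fun k hk => ?_
  rw [Nat.factorization_def _ Nat.prime_two,
    padicValNat.mul (pow_ne_zero _ (hk0 k hk)) (Nat.factorial_ne_zero _),
    padicValNat.pow, padicValNat.eq_zero_of_not_dvd (ho' k hk)]
  simp

theorem zNat_ne_zero' {n : ℕ} (μ : Nat.Partition n) (ho : ∀ p ∈ μ.parts, Odd p) :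
    zNat μ ≠ 0 := by
  have : zNat μ = ∏ k ∈ μ.parts.toFinset, (k ^ μ.parts.count k * Nat.factorial (μ.parts.count k)) := rfl
  rw [this]
  refine Finset.prod_ne_zero_iff.2 fun k hk =>
    mul_ne_zero (pow_ne_zero _ ?_) (Nat.factorial_ne_zero _)
  exact (ho k (Multiset.mem_toFinset.1 hk)).pos.ne'

theorem aux_half (m : Multiset ℕ) (ho : ∀ p ∈ m, Odd p) :
    m.sum = Multiset.card m + 2 * (m.map (fun p => (p - 1) / 2)).sum := by
  induction m using Multiset.induction_on with
  | empty => simp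
  | cons a s ih =>
    have h1 := ih fun p hp => ho p (Multiset.mem_cons_of_mem hp)
    obtain ⟨t, rfl⟩ := ho a (Multiset.mem_cons_self _ _)
    simp only [Multiset.sum_cons, Multiset.card_cons, Multiset.map_cons]
    omega

theorem aux_delta (m : Multiset ℕ) :
    (2 : FockR) ^ ((m.map (fun p => (p - 1) / 2)).sum) *
      monomial ((m.map (fun p => Finsupp.single ((p - 1) / 2) 1)).sum) (1 : ℚ) ∈ Delta := by
  induction m using Multiset.induction_on with
  | empty => simpa using Delta.one_mem
  | cons a s ih =>
    simp only [Multiset.sum_cons, Multiset.map_cons]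
    have e : monomial (Finsupp.single ((a - 1) / 2) 1 +
        (s.map (fun p => Finsupp.single ((p - 1) / 2) 1)).sum) (1 : ℚ) =
        (X ((a - 1) / 2) : FockR) *
          monomial ((s.map (fun p => Finsupp.single ((p - 1) / 2) 1)).sum) (1 : ℚ) := by
      rw [X, monomial_mul, one_mul]
    rw [e, pow_add, mul_mul_mul_comm]
    exact Delta.mul_mem (Subring.subset_closure (Or.inr ⟨_, rfl⟩)) ih

theorem aux_toExp (m : Multiset ℕ) (ho : ∀ p ∈ m, Odd p) (k : ℕ) :
    (m.map (fun p => Finsupp.single ((p - 1) / 2) 1)).sum k = m.count (2 * k + 1) := by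
  induction m using Multiset.induction_on with
  | empty => simp
  | cons a s ih =>
    have h1 := ih fun p hp => ho p (Multiset.mem_cons_of_mem hp)
    obtain ⟨t, rfl⟩ := ho a (Multiset.mem_cons_self _ _)
    simp only [Multiset.sum_cons, Multiset.map_cons, Finsupp.add_apply, Multiset.count_cons, h1,
      Finsupp.single_apply]
    have : (2 * t + 1 - 1) / 2 = t := by omega
    rw [this, add_comm]
    congr 1
    by_cases h : t = k
    · simp [h]
    · rw [if_neg h, if_neg (by omega)]

theorem aux_zExp {n : ℕ} (μ : Nat.Partition n) (ho : ∀ p ∈ μ.parts, Odd p) :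
    zExp (toExp μ) = zNat μ := by
  have hz : zNat μ = ∏ k ∈ μ.parts.toFinset, (k ^ μ.parts.count k * Nat.factorial (μ.parts.count k)) := rfl
  have ht : ∀ k, toExp μ k = μ.parts.count (2 * k + 1) := aux_toExp _ ho
  rw [hz, zExp]
  push_cast
  refine Finset.prod_bij (fun k _ => 2 * k + 1) ?_ ?_ ?_ ?_
  · intro k hk
    rw [Finsupp.mem_support_iff, ht] at hk
    exact Multiset.mem_toFinset.2 (Multiset.count_ne_zero.1 hk)
  · intro a _ b _ h
    simpa using h
  · intro p hp
    rw [Multiset.mem_toFinset] at hp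
    obtain ⟨t, rfl⟩ := ho p hp
    exact ⟨t, by rw [Finsupp.mem_support_iff, ht]; exact Multiset.count_ne_zero.2 hp, rfl⟩
  · intro k _
    rw [ht]
    push_cast
    rfl

theorem aux_inner (d : ℕ →₀ ℕ) (e : ℕ) :
    innerP ((2 : FockR) ^ e * monomial d 1) ((2 : FockR) ^ e * monomial d 1) =
      2 ^ (2 * e) * zExp d := by
  have h : (2 : FockR) ^ e * monomial d 1 = monomial d ((2 : ℚ) ^ e) := by
    have : (2 : FockR) = C 2 := (map_ofNat C 2).symm
    rw [this, ← C_pow, C_mul_monomial, mul_one]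
  rw [h, innerP, support_monomial, if_neg (by positivity)]
  simp [two_mul, pow_add]

theorem aux_set (n : ℕ) (hn : 1 ≤ n) :
    ∃ S : Finset ℕ, 0 ∉ S ∧ ∑ s ∈ S, s = n ∧ S.card = aFun n := by
  have h1 : aFun n * (aFun n + 1) ≤ 2 * n :=
    Nat.findGreatest_spec (P := fun m => m * (m + 1) ≤ 2 * n) (m := 1) hn (by omega)
  have h2 : 1 ≤ aFun n :=
    Nat.le_findGreatest (P := fun m => m * (m + 1) ≤ 2 * n) (m := 1) hn (by omega)
  obtain ⟨b, hb⟩ : ∃ b, aFun n = b + 1 := ⟨aFun n - 1, by omega⟩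
  rw [hb] at h1 ⊢
  have hs : (∑ s ∈ Finset.Icc 1 b, s) * 2 = b * (b + 1) := by
    have := Finset.sum_range_id_mul_two (b + 1)
    rw [Finset.range_eq_Ico, Finset.sum_eq_sum_Ico_succ_bot (by omega)] at this
    simp only [zero_add, Nat.add_sub_cancel] at this
    rw [mul_comm b, ← this]
    rfl
  have hle : ∑ s ∈ Finset.Icc 1 b, s + (b + 1) ≤ n := by nlinarith
  have hnot : n - ∑ s ∈ Finset.Icc 1 b, s ∉ Finset.Icc 1 b := by
    rw [Finset.mem_Icc]; omega
  refine ⟨insert (n - ∑ s ∈ Finset.Icc 1 b, s) (Finset.Icc 1 b), ?_, ?_, ?_⟩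
  · rw [Finset.mem_insert, Finset.mem_Icc]; omega
  · rw [Finset.sum_insert hnot]; omega
  · rw [Finset.card_insert_of_notMem hnot]; simp

theorem aux_main (n : ℕ) (hn : 1 ≤ n) :
    ∃ μ : Nat.Partition n, (∀ p ∈ μ.parts, Odd p) ∧
      Multiset.card μ.parts = padicValNat 2 (zNat μ) + aFun n := by
  obtain ⟨S, h0, hsum, hcard⟩ := aux_set n hn
  have ho := gParts_odd S h0
  refine ⟨⟨gParts S, fun {i} hi => (ho i hi).pos, by rw [gParts_sum, hsum]⟩, ho, ?_⟩
  rw [zNat_v2 _ ho, ← hcard, Finset.card_eq_sum_card_fiberwise (s := S)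
    (f := fun s => s / 2 ^ (padicValNat 2 s)) (t := (gParts S).toFinset), ← Finset.sum_add_distrib]
  · rw [← Multiset.toFinset_sum_count_eq]
    exact Finset.sum_congr rfl fun k _ => (gParts_count S k).symm
  · intro s hs
    simp only [Finset.mem_coe, Multiset.mem_toFinset, gParts, Multiset.mem_sum]
    exact ⟨s, hs, Multiset.mem_replicate.2 ⟨by positivity, rfl⟩⟩

/-- For every `n ≥ 1` there is a partition `μ` of `n` with odd parts such that
`ℓ(μ) - v₂(z_μ) = a(n)`; for `f = 2^{(n-ℓ(μ))/2} p_μ ∈ Δ` (a homogeneous element of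
degree `n` of `Δ`), the inner product `⟨f, f⟩` has 2-adic valuation exactly `n - a(n)`,
so the exponent `n - a(n)` in the divisibility bound for inner products of degree-`n`
elements of `Δ` cannot be improved. -/
theorem inner_product_bound_tight (n : ℕ) (hn : 1 ≤ n) :
    ∃ μ : Nat.Partition n, (∀ p ∈ μ.parts, Odd p) ∧
      (Multiset.card μ.parts : ℤ) - padicValNat 2 (zNat μ) = aFun n ∧
      (2 : FockR) ^ ((n - Multiset.card μ.parts) / 2) * pMu μ ∈ Delta ∧
      padicValRat 2
        (innerP ((2 : FockR) ^ ((n - Multiset.card μ.parts) / 2) * pMu μ)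
                ((2 : FockR) ^ ((n - Multiset.card μ.parts) / 2) * pMu μ)) =
        (n : ℤ) - aFun n := by
  obtain ⟨μ, ho, hc⟩ := aux_main n hn
  have hh := aux_half μ.parts ho
  rw [μ.parts_sum] at hh
  have he : (n - Multiset.card μ.parts) / 2 = (μ.parts.map (fun p => (p - 1) / 2)).sum := by omega
  refine ⟨μ, ho, by omega, ?_, ?_⟩
  · rw [he]
    exact aux_delta μ.parts
  · have hz : (zNat μ : ℚ) ≠ 0 := by exact_mod_cast zNat_ne_zero' μ ho
    have h2 : padicValRat 2 (2 : ℚ) = 1 := by simpa using padicValRat.self (p := 2) (by norm_num)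
    rw [pMu, aux_inner, aux_zExp μ ho, padicValRat.mul (by positivity) hz,
      padicValRat.pow, h2, padicValRat.of_nat, Nat.cast_mul]
    omega

end
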